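/- For all probability measures μ, μ' on E_{n-1} with 0 < μ(π_{n/n-1}) < ∞ and 0 < μ'(π_{n/n-1}) < ∞, every x_n ∈ S_n, all integers i, j ≥ 0 and every measurable f: E_n → ℝ with |f| ≤ 1, |(δ_{x_n} − ω_n(μ')) K_{n,μ'}^i (K_{n,μ'} − K_{n,μ}) K_{n,μ}^j (f)| ≤ (2 ρ_n^{i+j}/(1 − ρ_n)) ‖μ' − μ‖_tv, where for a finite signed measure ν on E_n, a (difference of) kernel(s) L and a bounded measurable g one writes νL(g) := ∫∫ g(y) L(x, dy) ν(dx), composed from left to right. -/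

import Mathlib

open MeasureTheory
open scoped ENNReal NNReal

namespace Paper

noncomputable section

/-- Total variation distance: `sup {|∫ f dμ - ∫ f dν| : f measurable, |f| ≤ 1}`. -/
def tvDist {Z : Type*} [MeasurableSpace Z] (μ ν : Measure Z) : ℝ :=
  ⨆ f : { f : Z → ℝ // Measurable f ∧ ∀ z, |f z| ≤ 1 },
    |(∫ z, f.1 z ∂μ) - ∫ z, f.1 z ∂ν|

/-- `m`-step iterate of a kernel. -/
def iterK {Z : Type*} [MeasurableSpace Z] (K : Z → Measure Z) : ℕ → Z → Measure Z
  | 0 => fun z => Measure.dirac z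
  | m + 1 => fun z => (iterK K m z).bind K

/-- Solution of the Poisson equation associated to `K` and `ω`. -/
def poissonSol {Z : Type*} [MeasurableSpace Z] (K : Z → Measure Z) (ω : Measure Z)
    (f : Z → ℝ) (z : Z) : ℝ :=
  ∑' i : ℕ, ((∫ y, f y ∂(iterK K i z)) - ∫ y, f y ∂ω)

/-- `(δ_{z0} - ω') K'^i (K' - K) K^j (g)`, composed from left to right. -/
def crossTerm {Z : Type*} [MeasurableSpace Z] (K K' : Z → Measure Z) (ω' : Measure Z)
    (g : Z → ℝ) (z0 : Z) (i j : ℕ) : ℝ :=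
  (∫ y, ((∫ a, (∫ b, g b ∂(iterK K j a)) ∂(K' y)) -
      ∫ a, (∫ b, g b ∂(iterK K j a)) ∂(K y)) ∂(iterK K' i z0)) -
    ∫ z, (∫ y, ((∫ a, (∫ b, g b ∂(iterK K j a)) ∂(K' y)) -
      ∫ a, (∫ b, g b ∂(iterK K j a)) ∂(K y)) ∂(iterK K' i z)) ∂ω'

variable {X Y : Type*} [MeasurableSpace X] [MeasurableSpace Y]

/-- The importance weight `w_n`. -/
def weight (γm : X → ℝ≥0∞) (γn q : X × Y → ℝ≥0∞) (p : X × Y) : ℝ≥0∞ :=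
  γn p / (γm p.1 * q p)

/-- The Metropolis–Hastings acceptance probability. -/
def accept (w : X × Y → ℝ≥0∞) (p p' : X × Y) : ℝ≥0∞ := min 1 (w p' / w p)

/-- The proposal distribution `μ × q_n`. -/
def proposal (dxY : Measure Y) (q : X × Y → ℝ≥0∞) (μ : Measure X) : Measure (X × Y) :=
  (μ.prod dxY).withDensity q

/-- The Metropolis–Hastings kernel `K_{n,μ}`. -/
def mhK (dxY : Measure Y) (γm : X → ℝ≥0∞) (γn q : X × Y → ℝ≥0∞) (μ : Measure X)
    (p : X × Y) : Measure (X × Y) :=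
  (proposal dxY q μ).withDensity (accept (weight γm γn q) p) +
    (1 - ∫⁻ p', accept (weight γm γn q) p p' ∂(proposal dxY q μ)) • Measure.dirac p

/-- The marginal density `π_n(x_{n-1})`. -/
def margN (dxY : Measure Y) (γn : X × Y → ℝ≥0∞) (Zn : ℝ≥0∞) (x : X) : ℝ≥0∞ :=
  (∫⁻ y, γn (x, y) ∂dxY) / Zn

/-- The ratio `π_{n/n-1}(x_{n-1}) = π_n(x_{n-1}) / π_{n-1}(x_{n-1})`. -/
def ratioN (dxY : Measure Y) (γm : X → ℝ≥0∞) (γn : X × Y → ℝ≥0∞) (Zm Zn : ℝ≥0∞)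
    (x : X) : ℝ≥0∞ :=
  margN dxY γn Zn x / (γm x / Zm)

/-- The conditional density `π̄_n(x_{n-1}, x)`. -/
def condN (dxY : Measure Y) (γn : X × Y → ℝ≥0∞) (Zn : ℝ≥0∞) (p : X × Y) : ℝ≥0∞ :=
  (γn p / Zn) / margN dxY γn Zn p.1

/-- The invariant distribution `ω_n(μ)`. -/
def omegaN (dxY : Measure Y) (γm : X → ℝ≥0∞) (γn : X × Y → ℝ≥0∞) (Zm Zn : ℝ≥0∞)
    (μ : Measure X) : Measure (X × Y) :=
  (∫⁻ x, ratioN dxY γm γn Zm Zn x ∂μ)⁻¹ •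
    (μ.prod dxY).withDensity fun p => ratioN dxY γm γn Zm Zn p.1 * condN dxY γn Zn p

section KernelIteration

variable {Z : Type*} [MeasurableSpace Z]

/-- The iterates of a Markov kernel, bundled as kernels. -/
def iterKernel (κ : ProbabilityTheory.Kernel Z Z) : ℕ → ProbabilityTheory.Kernel Z Z
  | 0 => ProbabilityTheory.Kernel.id
  | m + 1 => ProbabilityTheory.Kernel.comp κ (iterKernel κ m)

lemma iterKernel_apply (κ : ProbabilityTheory.Kernel Z Z) (m : ℕ) (z : Z) :
    iterKernel κ m z = iterK κ m z := by
  induction m generalizing z with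
  | zero => simp [iterKernel, iterK, ProbabilityTheory.Kernel.id_apply]
  | succ m ih => simp [iterKernel, iterK, ProbabilityTheory.Kernel.comp_apply, ih]

instance isMarkovKernel_iterKernel (κ : ProbabilityTheory.Kernel Z Z)
    [ProbabilityTheory.IsMarkovKernel κ] (m : ℕ) :
    ProbabilityTheory.IsMarkovKernel (iterKernel κ m) := by
  induction m with
  | zero => unfold iterKernel; infer_instance
  | succ m ih => unfold iterKernel; infer_instance

lemma isProbabilityMeasure_iterK (κ : ProbabilityTheory.Kernel Z Z)
    [ProbabilityTheory.IsMarkovKernel κ] (m : ℕ) (z : Z) :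
    IsProbabilityMeasure (iterK κ m z) := by
  rw [← iterKernel_apply]; infer_instance

lemma integrable_of_measurable_of_abs_le {P : Measure Z} [IsFiniteMeasure P] {g : Z → ℝ}
    (hg : Measurable g) {C : ℝ} (hC : ∀ z, |g z| ≤ C) : Integrable g P :=
  Integrable.of_bound hg.aestronglyMeasurable C (Filter.Eventually.of_forall hC)

lemma abs_integral_le_of_abs_le {P : Measure Z} [IsProbabilityMeasure P] {g : Z → ℝ}
    {C : ℝ} (hC : ∀ z, |g z| ≤ C) : |∫ z, g z ∂P| ≤ C := by
  have h := norm_integral_le_of_norm_le_const (μ := P) (f := g) (C := C)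
    (Filter.Eventually.of_forall hC)
  simpa using h

lemma measurable_integral_kernel {W : Type*} [MeasurableSpace W]
    (κ : ProbabilityTheory.Kernel W Z) {g : Z → ℝ}
    (hg : Measurable g) : Measurable fun w => ∫ y, g y ∂(κ w) :=
  hg.stronglyMeasurable.integral_kernel.measurable

lemma measurable_integral_iterK (κ : ProbabilityTheory.Kernel Z Z) {g : Z → ℝ}
    (hg : Measurable g) (m : ℕ) : Measurable fun w => ∫ y, g y ∂(iterK κ m w) := by
  simp_rw [← iterKernel_apply]
  exact measurable_integral_kernel _ hg

lemma integral_iterK_succ (κ : ProbabilityTheory.Kernel Z Z)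
    [ProbabilityTheory.IsMarkovKernel κ] {g : Z → ℝ} (hg : Measurable g) {C : ℝ}
    (hC : ∀ z, |g z| ≤ C) (m : ℕ) (z : Z) :
    ∫ y, g y ∂(iterK κ (m + 1) z) = ∫ x, ∫ y, g y ∂(κ x) ∂(iterK κ m z) := by
  rw [← iterKernel_apply, ← iterKernel_apply]
  exact ProbabilityTheory.Kernel.integral_comp (integrable_of_measurable_of_abs_le hg hC)

lemma iterK_compl_eq_zero (κ : ProbabilityTheory.Kernel Z Z) {S : Set Z} (hS : MeasurableSet S)
    (hκS : ∀ p ∈ S, κ p Sᶜ = 0) (m : ℕ) {p : Z} (hp : p ∈ S) : iterK κ m p Sᶜ = 0 := by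
  induction m with
  | zero => simp [iterK, Measure.dirac_apply' _ hS.compl, hp]
  | succ m ih =>
    rw [iterK, Measure.bind_apply hS.compl κ.measurable.aemeasurable]
    rw [lintegral_eq_zero_iff (κ.measurable_coe hS.compl)]
    have : ∀ᵐ x ∂(iterK κ m p), x ∈ S := by
      rw [ae_iff]; exact ih
    filter_upwards [this] with x hx using hκS x hx

/-- Geometric convergence of the iterates of `κ` to `ω`, uniformly over starting points in `S`. -/
def GeomErgodicOn (κ : ProbabilityTheory.Kernel Z Z) (ω : Measure Z) (S : Set Z) (ρ : ℝ) : Prop :=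
  ∀ p ∈ S, ∀ m : ℕ, ∀ f : Z → ℝ, Measurable f → (∀ z, |f z| ≤ 1) →
    |(∫ z, f z ∂(iterK κ m p)) - ∫ z, f z ∂ω| ≤ ρ ^ m

namespace GeomErgodicOn

variable {κ : ProbabilityTheory.Kernel Z Z} {ω : Measure Z} {S : Set Z} {ρ : ℝ}

lemma abs_sub_le (H : GeomErgodicOn κ ω S ρ) {p : Z} (hp : p ∈ S) (m : ℕ) {f : Z → ℝ}
    (hf : Measurable f) {c : ℝ} (hc : ∀ z, |f z| ≤ c) :
    |(∫ z, f z ∂(iterK κ m p)) - ∫ z, f z ∂ω| ≤ ρ ^ m * c := by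
  have hc0 : 0 ≤ c := (abs_nonneg _).trans (hc p)
  rcases hc0.eq_or_lt with rfl | hcpos
  · have : f = fun _ => 0 := funext fun z => abs_nonpos_iff.mp (hc z)
    simp [this]
  · have h := H p hp m (fun z => f z / c) (hf.div_const c) fun z => by
      rw [abs_div, abs_of_pos hcpos]; exact (div_le_one hcpos).2 (hc z)
    rw [integral_div, integral_div, ← sub_div, abs_div, abs_of_pos hcpos] at h
    exact (div_le_iff₀ hcpos).1 h

lemma tendsto (H : GeomErgodicOn κ ω S ρ) (hρ0 : 0 ≤ ρ) (hρ1 : ρ < 1) {p : Z} (hp : p ∈ S)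
    {f : Z → ℝ} (hf : Measurable f) {c : ℝ} (hc : ∀ z, |f z| ≤ c) :
    Filter.Tendsto (fun m => ∫ z, f z ∂(iterK κ m p)) Filter.atTop (nhds (∫ z, f z ∂ω)) := by
  rw [tendsto_iff_dist_tendsto_zero]
  refine squeeze_zero (fun _ => dist_nonneg) (fun m => H.abs_sub_le hp m hf hc) ?_
  simpa using (tendsto_pow_atTop_nhds_zero_of_lt_one hρ0 hρ1).mul_const c

variable [ProbabilityTheory.IsMarkovKernel κ]

lemma isProbabilityMeasure (H : GeomErgodicOn κ ω S ρ) (hρ0 : 0 ≤ ρ) (hρ1 : ρ < 1)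
    {p : Z} (hp : p ∈ S) : IsProbabilityMeasure ω := by
  have h := H.tendsto hρ0 hρ1 hp (f := fun _ => 1) measurable_const (c := 1) (by simp)
  have h1 : ∀ m, ∫ _, (1 : ℝ) ∂(iterK κ m p) = 1 := fun m => by
    have := isProbabilityMeasure_iterK κ m p
    simp
  simp_rw [h1] at h
  have h2 := tendsto_nhds_unique h tendsto_const_nhds
  refine ⟨?_⟩
  rw [integral_const, smul_eq_mul, mul_one] at h2
  exact (ENNReal.toReal_eq_one_iff _).1 h2

lemma measure_compl_eq_zero (H : GeomErgodicOn κ ω S ρ) (hρ0 : 0 ≤ ρ) (hρ1 : ρ < 1)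
    (hS : MeasurableSet S) (hκS : ∀ p ∈ S, κ p Sᶜ = 0) {p : Z} (hp : p ∈ S) : ω Sᶜ = 0 := by
  have := H.isProbabilityMeasure hρ0 hρ1 hp
  have h := H.tendsto hρ0 hρ1 hp (f := Sᶜ.indicator fun _ => 1)
    (measurable_const.indicator hS.compl) (c := 1) fun z => by
      by_cases hz : z ∈ Sᶜ <;> simp [hz]
  simp only [integral_indicator_const _ hS.compl, Measure.real, iterK_compl_eq_zero κ hS hκS _ hp,
    ENNReal.toReal_zero, smul_eq_mul, mul_one] at h
  have h2 := tendsto_nhds_unique h tendsto_const_nhds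
  exact ((ENNReal.toReal_eq_zero_iff _).1 h2).resolve_right (measure_ne_top _ _)

lemma integral_integral (H : GeomErgodicOn κ ω S ρ) (hρ0 : 0 ≤ ρ) (hρ1 : ρ < 1)
    {p : Z} (hp : p ∈ S) {f : Z → ℝ} (hf : Measurable f) {c : ℝ} (hc : ∀ z, |f z| ≤ c) :
    ∫ z, ∫ y, f y ∂(κ z) ∂ω = ∫ y, f y ∂ω := by
  have h1 := (Filter.tendsto_add_atTop_iff_nat 1).2 (H.tendsto hρ0 hρ1 hp hf hc)
  simp_rw [integral_iterK_succ κ hf hc] at h1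
  exact tendsto_nhds_unique (H.tendsto hρ0 hρ1 hp (measurable_integral_kernel κ hf)
    fun z => abs_integral_le_of_abs_le hc) h1

lemma integral_integral_iterK (H : GeomErgodicOn κ ω S ρ) (hρ0 : 0 ≤ ρ) (hρ1 : ρ < 1)
    {p : Z} (hp : p ∈ S) (i : ℕ) {f : Z → ℝ} (hf : Measurable f) {c : ℝ} (hc : ∀ z, |f z| ≤ c) :
    ∫ z, ∫ y, f y ∂(iterK κ i z) ∂ω = ∫ y, f y ∂ω := by
  induction i generalizing f with
  | zero =>
    refine integral_congr_ae (Filter.Eventually.of_forall fun z => ?_)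
    exact integral_dirac' f z hf.stronglyMeasurable
  | succ i ih =>
    simp_rw [integral_iterK_succ κ hf hc]
    rw [ih (measurable_integral_kernel κ hf) fun z => abs_integral_le_of_abs_le hc]
    exact H.integral_integral hρ0 hρ1 hp hf hc

lemma abs_integral_iterK_sub_le (H : GeomErgodicOn κ ω S ρ) (hρ0 : 0 ≤ ρ) (hρ1 : ρ < 1)
    (hS : MeasurableSet S) (hκS : ∀ p ∈ S, κ p Sᶜ = 0) {p : Z} (hp : p ∈ S) (i : ℕ)
    {h : Z → ℝ} (hh : Measurable h) {c : ℝ} (hc : ∀ z ∈ S, |h z| ≤ c) :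
    |(∫ y, h y ∂(iterK κ i p)) - ∫ z, ∫ y, h y ∂(iterK κ i z) ∂ω| ≤ ρ ^ i * c := by
  have hc0 : 0 ≤ c := (abs_nonneg _).trans (hc p hp)
  have hmeas : Measurable (S.indicator h) := hh.indicator hS
  have hbd : ∀ z, |S.indicator h z| ≤ c := fun z => by
    by_cases hz : z ∈ S
    · simpa [hz] using hc z hz
    · simpa [hz] using hc0
  have hint : ∀ z ∈ S, ∫ y, h y ∂(iterK κ i z) = ∫ y, S.indicator h y ∂(iterK κ i z) := by
    intro z hz
    have : ∀ᵐ x ∂(iterK κ i z), x ∈ S := by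
      rw [ae_iff]; exact iterK_compl_eq_zero κ hS hκS i hz
    refine integral_congr_ae ?_
    filter_upwards [this] with x hx
    simp [hx]
  have hωS : ∀ᵐ x ∂ω, x ∈ S := by
    rw [ae_iff]; exact H.measure_compl_eq_zero hρ0 hρ1 hS hκS hp
  have hω : ∫ z, ∫ y, h y ∂(iterK κ i z) ∂ω = ∫ y, S.indicator h y ∂ω := by
    rw [← H.integral_integral_iterK hρ0 hρ1 hp i hmeas hbd]
    refine integral_congr_ae ?_
    filter_upwards [hωS] with x hx using hint x hx
  rw [hω, hint p hp]
  exact H.abs_sub_le hp i hmeas hbd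

end GeomErgodicOn

end KernelIteration

section TotalVariation

variable {Z : Type*} [MeasurableSpace Z]

lemma bddAbove_tvDist (μ ν : Measure Z) [IsProbabilityMeasure μ] [IsProbabilityMeasure ν] :
    BddAbove (Set.range fun f : { f : Z → ℝ // Measurable f ∧ ∀ z, |f z| ≤ 1 } =>
      |(∫ z, f.1 z ∂μ) - ∫ z, f.1 z ∂ν|) := by
  refine ⟨2, ?_⟩
  rintro _ ⟨f, rfl⟩
  have h1 : |∫ z, f.1 z ∂μ| ≤ 1 := abs_integral_le_of_abs_le f.2.2
  have h2 : |∫ z, f.1 z ∂ν| ≤ 1 := abs_integral_le_of_abs_le f.2.2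
  have h3 := abs_sub (∫ z, f.1 z ∂μ) (∫ z, f.1 z ∂ν)
  simp only
  linarith

lemma tvDist_nonneg (μ ν : Measure Z) : 0 ≤ tvDist μ ν :=
  Real.iSup_nonneg fun _ => abs_nonneg _

lemma abs_integral_sub_integral_le_tvDist (μ ν : Measure Z) [IsProbabilityMeasure μ]
    [IsProbabilityMeasure ν] {F : Z → ℝ} (hF : Measurable F) {c : ℝ} (hc : ∀ z, |F z| ≤ c) :
    |(∫ z, F z ∂μ) - ∫ z, F z ∂ν| ≤ c * tvDist μ ν := by
  have : Nonempty Z := nonempty_of_isProbabilityMeasure μ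
  have hc0 : 0 ≤ c := (abs_nonneg _).trans (hc (Classical.arbitrary Z))
  rcases hc0.eq_or_lt with rfl | hcpos
  · have : F = fun _ => 0 := funext fun z => abs_nonpos_iff.mp (hc z)
    simp [this]
  · have h := le_ciSup (bddAbove_tvDist μ ν) ⟨fun z => F z / c, hF.div_const c, fun z => by
      rw [abs_div, abs_of_pos hcpos]; exact (div_le_one hcpos).2 (hc z)⟩
    simp only [integral_div, ← sub_div, abs_div, abs_of_pos hcpos] at h
    rw [mul_comm]
    exact (div_le_iff₀ hcpos).1 h

end TotalVariation

section MetropolisHastings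

lemma integral_withDensity_add_smul_dirac {Z : Type*} [MeasurableSpace Z] (P : Measure Z)
    [IsProbabilityMeasure P] {a : Z → ℝ≥0∞} (ha : Measurable a) (ha1 : ∀ z, a z ≤ 1)
    {g : Z → ℝ} (hg : Measurable g) {C : ℝ} (hC : ∀ z, |g z| ≤ C) (y : Z) :
    ∫ z, g z ∂(P.withDensity a + (1 - ∫⁻ z, a z ∂P) • Measure.dirac y) =
      g y + ∫ z, (a z).toReal * (g z - g y) ∂P := by
  have hlt : ∀ z, a z < ⊤ := fun z => (ha1 z).trans_lt ENNReal.one_lt_top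
  have hle : ∫⁻ z, a z ∂P ≤ 1 := by
    simpa using lintegral_mono (μ := P) ha1
  have : IsFiniteMeasure (P.withDensity a) :=
    isFiniteMeasure_withDensity (hle.trans_lt ENNReal.one_lt_top).ne
  have hsub : (1 - ∫⁻ z, a z ∂P) ≠ ⊤ := (tsub_le_self.trans_lt ENNReal.one_lt_top).ne
  have hatr : ∀ z, |(a z).toReal| ≤ 1 := fun z => by
    rw [abs_of_nonneg ENNReal.toReal_nonneg]
    exact ENNReal.toReal_le_of_le_ofReal zero_le_one (by simpa using ha1 z)
  have hia : Integrable (fun z => (a z).toReal) P :=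
    integrable_of_measurable_of_abs_le ha.ennreal_toReal hatr
  have hiag : Integrable (fun z => (a z).toReal * g z) P :=
    integrable_of_measurable_of_abs_le (C := 1 * C) (ha.ennreal_toReal.mul hg) fun z => by
      rw [abs_mul]
      exact mul_le_mul (hatr z) (hC z) (abs_nonneg _) zero_le_one
  rw [integral_add_measure (integrable_of_measurable_of_abs_le hg hC)
      ((integrable_of_measurable_of_abs_le hg hC).smul_measure hsub),
    integral_withDensity_eq_integral_toReal_smul ha (Filter.Eventually.of_forall hlt),
    integral_smul_measure, integral_dirac' g y hg.stronglyMeasurable,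
    ENNReal.toReal_sub_of_le hle ENNReal.one_ne_top,
    ← integral_toReal ha.aemeasurable (Filter.Eventually.of_forall hlt)]
  simp_rw [mul_sub, smul_eq_mul]
  rw [integral_sub hiag (hia.mul_const _), integral_mul_const, ENNReal.toReal_one]
  ring

lemma isMarkovKernel_withDensity (dxY : Measure Y) [SigmaFinite dxY] {q : X × Y → ℝ≥0∞}
    (hq : Measurable q) (hqdens : ∀ x, ∫⁻ y, q (x, y) ∂dxY = 1) :
    ProbabilityTheory.IsMarkovKernel
      ((ProbabilityTheory.Kernel.const X dxY).withDensity fun x y => q (x, y)) := by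
  refine ⟨fun x => ⟨?_⟩⟩
  rw [ProbabilityTheory.Kernel.withDensity_apply _ (by exact hq)]
  simp [hqdens]

lemma proposal_eq_compProd (dxY : Measure Y) [SigmaFinite dxY] {q : X × Y → ℝ≥0∞}
    (hq : Measurable q) (hqdens : ∀ x, ∫⁻ y, q (x, y) ∂dxY = 1) (μ : Measure X) [SFinite μ] :
    proposal dxY q μ =
      μ.compProd ((ProbabilityTheory.Kernel.const X dxY).withDensity fun x y => q (x, y)) := by
  have := isMarkovKernel_withDensity dxY hq hqdens
  ext s hs
  rw [proposal, withDensity_apply _ hs, Measure.compProd_apply hs, ← lintegral_indicator hs,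
    lintegral_prod _ (hq.indicator hs).aemeasurable]
  refine lintegral_congr fun x => ?_
  rw [ProbabilityTheory.Kernel.withDensity_apply _ (by exact hq),
    ProbabilityTheory.Kernel.const_apply, withDensity_apply _ (measurable_prodMk_left hs),
    ← lintegral_indicator (measurable_prodMk_left hs)]
  rfl

lemma isProbabilityMeasure_proposal (dxY : Measure Y) [SigmaFinite dxY] {q : X × Y → ℝ≥0∞}
    (hq : Measurable q) (hqdens : ∀ x, ∫⁻ y, q (x, y) ∂dxY = 1) (μ : Measure X)
    [IsProbabilityMeasure μ] : IsProbabilityMeasure (proposal dxY q μ) := by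
  have := isMarkovKernel_withDensity dxY hq hqdens
  rw [proposal_eq_compProd dxY hq hqdens]
  infer_instance

variable {γm : X → ℝ≥0∞} {γn q : X × Y → ℝ≥0∞}

lemma measurable_weight (hγm : Measurable γm) (hγn : Measurable γn) (hq : Measurable q) :
    Measurable (weight γm γn q) :=
  hγn.div ((hγm.comp measurable_fst).mul hq)

lemma measurable_uncurry_accept {w : X × Y → ℝ≥0∞} (hw : Measurable w) :
    Measurable (Function.uncurry (accept w)) :=
  measurable_const.min ((hw.comp measurable_snd).div (hw.comp measurable_fst))

lemma measurable_accept {w : X × Y → ℝ≥0∞} (hw : Measurable w) (p : X × Y) :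
    Measurable (accept w p) :=
  measurable_const.min (hw.div measurable_const)

lemma accept_le_one {X Y : Type*} (w : X × Y → ℝ≥0∞) (p p' : X × Y) : accept w p p' ≤ 1 :=
  min_le_left _ _

lemma accept_eq_zero {X Y : Type*} {γm : X → ℝ≥0∞} {γn q : X × Y → ℝ≥0∞} {z : X × Y} (hz : γn z = 0) (p : X × Y) :
    accept (weight γm γn q) p z = 0 := by
  simp [accept, weight, hz]

lemma measurable_mhK (dxY : Measure Y) [SigmaFinite dxY] (hγm : Measurable γm)
    (hγn : Measurable γn) (hq : Measurable q) (hqdens : ∀ x, ∫⁻ y, q (x, y) ∂dxY = 1)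
    (μ : Measure X) [IsProbabilityMeasure μ] : Measurable (mhK dxY γm γn q μ) := by
  have := isProbabilityMeasure_proposal dxY hq hqdens μ
  have hw := measurable_uncurry_accept (measurable_weight hγm hγn hq)
  refine Measure.measurable_of_measurable_coe _ fun s hs => ?_
  have h1 : Measurable fun p : X × Y => ∫⁻ p', accept (weight γm γn q) p p' ∂(proposal dxY q μ) :=
    hw.lintegral_prod_right'
  have h2 : Measurable fun p : X × Y =>
      ∫⁻ p' in s, accept (weight γm γn q) p p' ∂(proposal dxY q μ) :=
    hw.lintegral_prod_right'
  simp only [mhK, Measure.add_apply, Measure.smul_apply, withDensity_apply _ hs, smul_eq_mul,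
    Measure.dirac_apply' _ hs]
  exact h2.add ((measurable_const.sub h1).mul (measurable_one.indicator hs))

/-- The Metropolis–Hastings kernel, bundled as a `Kernel`. -/
def mhKernel (dxY : Measure Y) [SigmaFinite dxY] (hγm : Measurable γm)
    (hγn : Measurable γn) (hq : Measurable q) (hqdens : ∀ x, ∫⁻ y, q (x, y) ∂dxY = 1)
    (μ : Measure X) [IsProbabilityMeasure μ] : ProbabilityTheory.Kernel (X × Y) (X × Y) where
  toFun := mhK dxY γm γn q μ
  measurable' := measurable_mhK dxY hγm hγn hq hqdens μ

lemma isMarkovKernel_mhKernel (dxY : Measure Y) [SigmaFinite dxY] (hγm : Measurable γm)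
    (hγn : Measurable γn) (hq : Measurable q) (hqdens : ∀ x, ∫⁻ y, q (x, y) ∂dxY = 1)
    (μ : Measure X) [IsProbabilityMeasure μ] :
    ProbabilityTheory.IsMarkovKernel (mhKernel dxY hγm hγn hq hqdens μ) := by
  refine ⟨fun p => ⟨?_⟩⟩
  have := isProbabilityMeasure_proposal dxY hq hqdens μ
  have hle : ∫⁻ z, accept (weight γm γn q) p z ∂(proposal dxY q μ) ≤ 1 := by
    simpa using lintegral_mono (μ := proposal dxY q μ) (accept_le_one (weight γm γn q) p)
  change mhK dxY γm γn q μ p Set.univ = 1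
  simp [mhK, add_tsub_cancel_of_le hle]

lemma mhK_apply_eq_zero (dxY : Measure Y) (μ : Measure X) {S : Set (X × Y)}
    (hS : MeasurableSet S) (hSγ : ∀ z, z ∉ S → γn z = 0) {p : X × Y} (hp : p ∈ S) :
    mhK dxY γm γn q μ p Sᶜ = 0 := by
  have h : ∫⁻ z in Sᶜ, accept (weight γm γn q) p z ∂(proposal dxY q μ) = 0 := by
    rw [setLIntegral_congr_fun hS.compl fun z hz => accept_eq_zero (hSγ z hz) p]
    simp
  simp [mhK, withDensity_apply _ hS.compl, h, Measure.dirac_apply' _ hS.compl, hp]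

lemma abs_integral_mhK_sub_le (dxY : Measure Y) [SigmaFinite dxY] (hγm : Measurable γm)
    (hγn : Measurable γn) (hq : Measurable q) (hqdens : ∀ x, ∫⁻ y, q (x, y) ∂dxY = 1)
    (μ μ' : Measure X) [IsProbabilityMeasure μ] [IsProbabilityMeasure μ']
    {g : X × Y → ℝ} (hg : Measurable g) {C : ℝ} (hC : ∀ z, |g z| ≤ C) {y : X × Y} {c : ℝ}
    (hc0 : 0 ≤ c) (hc : ∀ z, γn z ≠ 0 → |g z - g y| ≤ c) :
    |(∫ z, g z ∂(mhK dxY γm γn q μ' y)) - ∫ z, g z ∂(mhK dxY γm γn q μ y)| ≤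
      c * tvDist μ' μ := by
  have := isMarkovKernel_withDensity dxY hq hqdens
  set κ := (ProbabilityTheory.Kernel.const X dxY).withDensity fun x y => q (x, y)
  set G : X × Y → ℝ := fun z => (accept (weight γm γn q) y z).toReal * (g z - g y)
  have ha := measurable_accept (measurable_weight hγm hγn hq) y
  have hG : Measurable G := ha.ennreal_toReal.mul (hg.sub_const _)
  have hGc : ∀ z, |G z| ≤ c := fun z => by
    by_cases hz : γn z = 0
    · simpa [G, accept_eq_zero hz y] using hc0
    · have h1 : (accept (weight γm γn q) y z).toReal ≤ 1 :=
        ENNReal.toReal_le_of_le_ofReal zero_le_one (by simpa using accept_le_one _ y z)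
      rw [abs_mul, abs_of_nonneg ENNReal.toReal_nonneg]
      simpa using mul_le_mul h1 (hc z hz) (abs_nonneg _) zero_le_one
  have key : ∀ ν : Measure X, IsProbabilityMeasure ν →
      ∫ z, g z ∂(mhK dxY γm γn q ν y) = g y + ∫ x, ∫ b, G (x, b) ∂(κ x) ∂ν := by
    intro ν _
    have := isProbabilityMeasure_proposal dxY hq hqdens ν
    rw [mhK, integral_withDensity_add_smul_dirac _ ha (accept_le_one _ y) hg hC,
      proposal_eq_compProd dxY hq hqdens,
      Measure.integral_compProd (integrable_of_measurable_of_abs_le hG hGc)]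
  rw [key μ ‹_›, key μ' ‹_›, add_sub_add_left_eq_sub]
  refine abs_integral_sub_integral_le_tvDist μ' μ ?_ fun x =>
    abs_integral_le_of_abs_le fun b => hGc (x, b)
  exact (hG.stronglyMeasurable.integral_kernel_prod_right' (κ := κ)).measurable

end MetropolisHastings

theorem statement8
    (dxm : Measure X) [SigmaFinite dxm] (dxY : Measure Y) [SigmaFinite dxY]
    (γm : X → ℝ≥0∞) (γn q : X × Y → ℝ≥0∞)
    (hγm : Measurable γm) (hγmfin : ∀ x, γm x ≠ ⊤)
    (hγn : Measurable γn) (hγnfin : ∀ p, γn p ≠ ⊤)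
    (Zm Zn : ℝ≥0∞)
    (hZm : Zm = ∫⁻ x, γm x ∂dxm) (hZm0 : 0 < Zm) (hZmt : Zm ≠ ⊤)
    (hZn : Zn = ∫⁻ p, γn p ∂(dxm.prod dxY)) (hZn0 : 0 < Zn) (hZnt : Zn ≠ ⊤)
    (hq : Measurable q) (hqpos : ∀ p, 0 < q p) (hqfin : ∀ p, q p ≠ ⊤)
    (hqdens : ∀ x, ∫⁻ y, q (x, y) ∂dxY = 1)
    (B : ℝ≥0∞) (hBt : B ≠ ⊤)
    (hA1 : ∀ p : X × Y, 0 < γn p / Zn → weight γm γn q p ≤ B)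
    (ρ : ℝ) (hρ0 : 0 ≤ ρ) (hρ1 : ρ < 1)
    (hunif : ∀ ξ : Measure X, IsProbabilityMeasure ξ →
      0 < ∫⁻ x, ratioN dxY γm γn Zm Zn x ∂ξ →
      (∫⁻ x, ratioN dxY γm γn Zm Zn x ∂ξ) ≠ ⊤ →
      ∀ p : X × Y, 0 < γn p / Zn → ∀ m : ℕ, ∀ f : X × Y → ℝ, Measurable f →
        (∀ z, |f z| ≤ 1) →
        |(∫ z, f z ∂(iterK (mhK dxY γm γn q ξ) m p)) -
            ∫ z, f z ∂(omegaN dxY γm γn Zm Zn ξ)| ≤ ρ ^ m)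
    :
    ∀ μ μ' : Measure X, IsProbabilityMeasure μ → IsProbabilityMeasure μ' →
      0 < ∫⁻ x, ratioN dxY γm γn Zm Zn x ∂μ →
      (∫⁻ x, ratioN dxY γm γn Zm Zn x ∂μ) ≠ ⊤ →
      0 < ∫⁻ x, ratioN dxY γm γn Zm Zn x ∂μ' →
      (∫⁻ x, ratioN dxY γm γn Zm Zn x ∂μ') ≠ ⊤ →
      ∀ p : X × Y, 0 < γn p / Zn → ∀ i j : ℕ,
      ∀ f : X × Y → ℝ, Measurable f → (∀ z, |f z| ≤ 1) →
        |crossTerm (mhK dxY γm γn q μ) (mhK dxY γm γn q μ')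
            (omegaN dxY γm γn Zm Zn μ') f p i j| ≤
          2 * ρ ^ (i + j) / (1 - ρ) * tvDist μ' μ := by
  intro μ μ' hμ hμ' h1 h2 h1' h2' p hp i j f hf hf1
  have := isMarkovKernel_mhKernel dxY hγm hγn hq hqdens μ
  have := isMarkovKernel_mhKernel dxY hγm hγn hq hqdens μ'
  set κ := mhKernel dxY hγm hγn hq hqdens μ
  set κ' := mhKernel dxY hγm hγn hq hqdens μ'
  set S : Set (X × Y) := {z | 0 < γn z / Zn}
  have hS : MeasurableSet S := measurableSet_lt measurable_const (hγn.div_const Zn)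
  have hSγ : ∀ z, z ∉ S → γn z = 0 := fun z hz => by
    have hz0 : γn z / Zn = 0 := nonpos_iff_eq_zero.1 (not_lt.1 hz)
    exact (ENNReal.div_eq_zero_iff.1 hz0).resolve_right hZnt
  have hγS : ∀ z, γn z ≠ 0 → z ∈ S := fun z hz => by_contra fun h => hz (hSγ z h)
  have H : GeomErgodicOn κ (omegaN dxY γm γn Zm Zn μ) S ρ := hunif μ hμ h1 h2
  have H' : GeomErgodicOn κ' (omegaN dxY γm γn Zm Zn μ') S ρ := hunif μ' hμ' h1' h2'
  have hκ' : ∀ z ∈ S, κ' z Sᶜ = 0 := fun z hz => mhK_apply_eq_zero dxY μ' hS hSγ hz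
  set g : X × Y → ℝ := fun a => ∫ b, f b ∂(iterK κ j a)
  have hg : Measurable g := measurable_integral_iterK κ hf j
  have hg1 : ∀ z, |g z| ≤ 1 := fun z => by
    have := isProbabilityMeasure_iterK κ j z
    exact abs_integral_le_of_abs_le hf1
  have hdiff : ∀ y ∈ S, |(∫ a, g a ∂(κ' y)) - ∫ a, g a ∂(κ y)| ≤
      2 * ρ ^ j * tvDist μ' μ := fun y hy => by
    refine abs_integral_mhK_sub_le dxY hγm hγn hq hqdens μ μ' hg hg1 (by positivity)
      fun z hz => ?_
    have hz' := abs_le.1 (H z (hγS z hz) j f hf hf1)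
    have hy' := abs_le.1 (H y hy j f hf hf1)
    exact abs_le.2 ⟨by simp only [g]; linarith, by simp only [g]; linarith⟩
  have hmain := H'.abs_integral_iterK_sub_le hρ0 hρ1 hS hκ' hp i
    ((measurable_integral_kernel κ' hg).sub (measurable_integral_kernel κ hg)) hdiff
  refine (show |crossTerm κ κ' (omegaN dxY γm γn Zm Zn μ') f p i j| ≤ _ from hmain).trans ?_
  have htv := tvDist_nonneg μ' μ
  have hle : 2 * ρ ^ (i + j) ≤ 2 * ρ ^ (i + j) / (1 - ρ) :=
    le_div_self (by positivity) (by linarith) (by linarith)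
  calc ρ ^ i * (2 * ρ ^ j * tvDist μ' μ) = 2 * ρ ^ (i + j) * tvDist μ' μ := by
        rw [pow_add]; ring
    _ ≤ _ := mul_le_mul_of_nonneg_right hle htv

end

end Paper
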